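/- If T = T(μ, κ; ν) is a leading tableau and (T', T') = RSK(T, T) is its image under the skew RSK map, then T' is again a leading tableau with T' = T(μ, κ + μ'; ν): the skew RSK map acts on leading tableaux by the linear shift κ ↦ κ + μ' (componentwise addition of the conjugate partition). -/

import Mathlib

/-- A (generalized) filled skew tableau: `lam r` / `rho r` are the outer and inner
shape of row `r ∈ ℤ`, and `ent r c` is the entry in row `r` and (0-based) column
`c`, with `0` denoting an empty cell. -/
structure Tab where
  lam : ℤ → ℕ
  rho : ℤ → ℕ
  ent : ℤ → ℕ → ℕ

/-- The cell `(r,c)` belongs to the skew shape of `T`. -/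
def inSh (T : Tab) (r : ℤ) (c : ℕ) : Prop := T.rho r ≤ c ∧ c < T.lam r

/-- `lam/rho` is a (generalized) skew Young diagram. -/
def validShape (T : Tab) : Prop :=
  ∃ r0 N : ℤ,
    (∀ r : ℤ, r < r0 → T.lam r = 0 ∧ T.rho r = 0) ∧
    (∀ r r' : ℤ, r0 ≤ r → r ≤ r' → T.lam r' ≤ T.lam r ∧ T.rho r' ≤ T.rho r) ∧
    (∀ r : ℤ, N ≤ r → T.lam r = 0) ∧
    (∀ r : ℤ, T.rho r ≤ T.lam r)

/-- Semistandard skew tableau with entries in `{1,…,n}`. -/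
def isSSYT (n : ℕ) (T : Tab) : Prop :=
  validShape T ∧
  (∀ r c, T.ent r c ≠ 0 ↔ inSh T r c) ∧
  (∀ r c, T.ent r c ≤ n) ∧
  (∀ (r : ℤ) (c c' : ℕ), T.rho r ≤ c → c ≤ c' → c' < T.lam r →
    T.ent r c ≤ T.ent r c') ∧
  (∀ r c, inSh T r c → inSh T (r + 1) c → T.ent r c < T.ent (r + 1) c)

/-- Rows `≥ rMax T` are empty. -/
noncomputable def rMax (T : Tab) : ℤ := sInf {m : ℤ | ∀ r : ℤ, m ≤ r → T.lam r = 0}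

/-- Rows `< rMin T` are empty. -/
noncomputable def rMin (T : Tab) : ℤ := sSup {m : ℤ | ∀ r : ℤ, r < m → T.lam r = 0}

/-- Schensted bumping of a value `v` into row `r` (and, recursively, below):
`v` replaces the entry of the leftmost cell of row `r` whose entry exceeds `v`,
which is in turn bumped to the next row; if no such cell exists, `v` is appended
at the right end of row `r`.  `fuel` bounds the recursion depth. -/
def bump : ℕ → Tab → ℤ → ℕ → Tab
  | 0, T, _, _ => T
  | fuel + 1, T, r, v =>
    let bigger := (Finset.Ico (T.rho r) (T.lam r)).filter fun c => v < T.ent r c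
    if h : bigger.Nonempty then
      let c := bigger.min' h
      let w := T.ent r c
      bump fuel
        { lam := T.lam, rho := T.rho,
          ent := fun r' c' => if r' = r ∧ c' = c then v else T.ent r' c' }
        (r + 1) w
    else
      { lam := fun r' => if r' = r then T.lam r + 1 else T.lam r',
        rho := T.rho,
        ent := fun r' c' => if r' = r ∧ c' = T.lam r then v else T.ent r' c' }

/-- The internal insertion `R_{[r]}`: vacate the leftmost cell of row `r` and insert
its value in the row below, following Schensted's bumping algorithm.  If row `r`
consists only of empty cells, an extra empty cell is created at row `r`. -/
noncomputable def intIns (T : Tab) (r : ℤ) : Tab :=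
  if T.rho r < T.lam r then
    bump ((rMax T - r).toNat + 2)
      { lam := T.lam,
        rho := fun r' => if r' = r then T.rho r + 1 else T.rho r',
        ent := fun r' c' => if r' = r ∧ c' = T.rho r then 0 else T.ent r' c' }
      (r + 1) (T.ent r (T.rho r))
  else
    { lam := fun r' => if r' = r then T.lam r + 1 else T.lam r',
      rho := fun r' => if r' = r then T.rho r + 1 else T.rho r',
      ent := T.ent }

/-- The number of `1`-cells in row `r` of `Q`. -/
def ones (Q : Tab) (r : ℤ) : ℕ :=
  ((Finset.Ico (Q.rho r) (Q.lam r)).filter fun c => Q.ent r c = 1).card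

/-- Internal insertion with cycling `ι₂`: apply internal insertions to `P` at the
rows of the `1`-cells of `Q` (in weakly decreasing order of rows), and let the new
recording tableau be obtained from `Q` by deleting all `1`-cells, decreasing all
remaining labels by `1`, and adding `n`-cells to match the shape of the new
insertion tableau. -/
noncomputable def iota2 (n : ℕ) (PQ : Tab × Tab) : Tab × Tab :=
  let P := PQ.1
  let Q := PQ.2
  let rows : List ℤ :=
    (List.range (rMax Q - rMin Q).toNat).map fun t => rMax Q - 1 - (t : ℤ)
  let P' := rows.foldl (fun S r => (fun S' => intIns S' r)^[ones Q r] S) P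
  let Q' : Tab :=
    { lam := P'.lam, rho := P'.rho,
      ent := fun r c =>
        if P'.rho r ≤ c ∧ c < P'.lam r then
          if Q.rho r + ones Q r ≤ c ∧ c < Q.lam r then Q.ent r c - 1 else n
        else 0 }
  (P', Q')

def swapP (PQ : Tab × Tab) : Tab × Tab := (PQ.2, PQ.1)

/-- `ι₁ := swap ∘ ι₂ ∘ swap`. -/
noncomputable def iota1 (n : ℕ) (PQ : Tab × Tab) : Tab × Tab :=
  swapP (iota2 n (swapP PQ))

/-- The skew RSK map, `RSK = ι₂ⁿ` (for pairs of tableaux with entries in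
`{1,…,n}`). -/
noncomputable def skewRSKt (n : ℕ) : Tab × Tab → Tab × Tab := (iota2 n)^[n]

/-- `conj f c` is the length of the `(c+1)`-st column of the partition `f`. -/
noncomputable def conj (f : ℕ → ℕ) (c : ℕ) : ℕ := Nat.card {r : ℕ | c + 1 ≤ f r}

/-- The row-coordinate matrix `α = ∑_{c=1}^{μ₁} A(μ'_c, κ_c)` of a leading tableau:
`aMat μ κ i r` is the number of `(i+1)`-cells in row `r+1`, where `A(m,k)` has
1-based entries `A(m,k)_{i,j} = δ_{i, j-k} 1_{i ≤ m}`. -/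
noncomputable def aMat (μ κ : ℕ → ℕ) (i r : ℕ) : ℕ :=
  ((Finset.range (μ 0)).filter fun c => i < conj μ c ∧ r = κ c + i).card

/-- The length of row `r+1` of the leading tableau. -/
noncomputable def thetaRow (μ κ : ℕ → ℕ) (r : ℕ) : ℕ :=
  ∑ i ∈ Finset.range (r + 1), aMat μ κ i r

/-- The inner shape `ρ = (κ⁺)' + ν` of the leading tableau `T(μ,κ;ν)`. -/
noncomputable def rhoLd (μ κ ν : ℕ → ℕ) (r : ℕ) : ℕ :=
  ((Finset.range (μ 0)).filter fun c => r + 1 ≤ κ c).card + ν r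

/-- The entry at offset `o` in row `r+1` of the leading tableau: the letters of row
`r+1` are those `i+1` with `aMat μ κ i r` repetitions, arranged increasingly. -/
noncomputable def entLd (μ κ : ℕ → ℕ) (r o : ℕ) : ℕ :=
  1 + sInf {i : ℕ | o < ∑ i' ∈ Finset.range (i + 1), aMat μ κ i' r}

/-- The leading tableau `T(μ, κ; ν)`. -/
noncomputable def leadingTab (μ κ ν : ℕ → ℕ) : Tab :=
  { lam := fun r => if 0 ≤ r then rhoLd μ κ ν r.toNat + thetaRow μ κ r.toNat else 0,
    rho := fun r => if 0 ≤ r then rhoLd μ κ ν r.toNat else 0,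
    ent := fun r c =>
      if 0 ≤ r ∧ rhoLd μ κ ν r.toNat ≤ c ∧
          c < rhoLd μ κ ν r.toNat + thetaRow μ κ r.toNat then
        entLd μ κ r.toNat (c - rhoLd μ κ ν r.toNat)
      else 0 }

/-- Schensted insertion of `v` into a row, returning the new row and the bumped letter. -/
def rowIns (v : ℕ) : List ℕ → List ℕ × Option ℕ
  | [] => ([v], none)
  | a :: l => if v < a then (v :: l, some a) else (a :: (rowIns v l).1, (rowIns v l).2)

/-- Successive Schensted insertion of a word into a row, returning the new row and the
word of bumped letters. -/
def wordIns : List ℕ → List ℕ → List ℕ × List ℕ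
  | [], l => (l, [])
  | x :: xs, l =>
    ((wordIns xs (rowIns x l).1).1, (rowIns x l).2.toList ++ (wordIns xs (rowIns x l).1).2)

theorem wordIns_concat (xs : List ℕ) (v : ℕ) (l : List ℕ) :
    wordIns (xs ++ [v]) l = ((rowIns v (wordIns xs l).1).1,
      (wordIns xs l).2 ++ (rowIns v (wordIns xs l).1).2.toList) := by
  induction xs generalizing l with
  | nil => simp [wordIns]
  | cons x xs ih => simp [wordIns, ih]

theorem rowIns_cases (v : ℕ) (l : List ℕ) :
    ((∀ a ∈ l, a ≤ v) ∧ rowIns v l = (l ++ [v], none)) ∨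
    ∃ j, ∃ hj : j < l.length, v < l[j] ∧ (∀ i (hi : i < j), l[i] ≤ v) ∧
      rowIns v l = (l.set j v, some l[j]) := by
  induction l with
  | nil => left; simp [rowIns]
  | cons a l ih =>
    by_cases h : v < a
    · right
      exact ⟨0, by simp, by simpa using h, by simp, by simp [rowIns, h]⟩
    · rcases ih with ⟨h1, h2⟩ | ⟨j, hj, h1, h2, h3⟩
      · left
        refine ⟨by simpa using ⟨not_lt.mp h, h1⟩, by simp [rowIns, h, h2]⟩
      · right
        refine ⟨j + 1, by simpa using hj, by simpa using h1, ?_, by simp [rowIns, h, h3]⟩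
        intro i hi
        rcases i with _ | i
        · simpa using h
        · simpa using h2 i (by omega)

/-- The filled tableau with inner shape `ρ` and row words `L`, with rows indexed by `ℕ`. -/
def ofRows (ρ : ℕ → ℕ) (L : ℕ → List ℕ) : Tab where
  lam := fun r => if 0 ≤ r then ρ r.toNat + (L r.toNat).length else 0
  rho := fun r => if 0 ≤ r then ρ r.toNat else 0
  ent := fun r c => if 0 ≤ r ∧ ρ r.toNat ≤ c then (L r.toNat).getD (c - ρ r.toNat) 0 else 0

theorem Tab.ext_fields {S T : Tab} (h1 : ∀ r, S.lam r = T.lam r) (h2 : ∀ r, S.rho r = T.rho r)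
    (h3 : ∀ r c, S.ent r c = T.ent r c) : S = T := by
  cases S; cases T
  simp only [Tab.mk.injEq]
  exact ⟨funext h1, funext h2, funext fun r => funext (h3 r)⟩

@[simp] theorem ofRows_lam_natCast (ρ : ℕ → ℕ) (L : ℕ → List ℕ) (r : ℕ) :
    (ofRows ρ L).lam r = ρ r + (L r).length := by simp [ofRows]

@[simp] theorem ofRows_rho_natCast (ρ : ℕ → ℕ) (L : ℕ → List ℕ) (r : ℕ) :
    (ofRows ρ L).rho r = ρ r := by simp [ofRows]

@[simp] theorem ofRows_ent_natCast (ρ : ℕ → ℕ) (L : ℕ → List ℕ) (r c : ℕ) :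
    (ofRows ρ L).ent r c = if ρ r ≤ c then (L r).getD (c - ρ r) 0 else 0 := by simp [ofRows]

/-- A filled tableau supported on the rows `r ≥ 0` is determined by those rows. -/
theorem eq_ofRows {T : Tab} {ρ : ℕ → ℕ} {L : ℕ → List ℕ}
    (hl : ∀ r < 0, T.lam r = 0) (hr : ∀ r < 0, T.rho r = 0) (he : ∀ r < 0, ∀ c, T.ent r c = 0)
    (hl' : ∀ r : ℕ, T.lam r = ρ r + (L r).length) (hr' : ∀ r : ℕ, T.rho r = ρ r)
    (hent : ∀ r c : ℕ, T.ent r c = if ρ r ≤ c then (L r).getD (c - ρ r) 0 else 0) :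
    T = ofRows ρ L := by
  refine Tab.ext_fields (fun r => ?_) (fun r => ?_) (fun r c => ?_) <;>
    rcases lt_or_ge r 0 with h | h
  · simp [ofRows, hl r h, h.not_ge]
  · lift r to ℕ using h; simp [hl']
  · simp [ofRows, hr r h, h.not_ge]
  · lift r to ℕ using h; simp [hr']
  · simp [ofRows, he r h, h.not_ge]
  · lift r to ℕ using h; simp [hent]

/-- Schensted bumping on row words, with `bump`'s recursion bound. -/
def bumpRows : ℕ → (ℕ → List ℕ) → ℕ → ℕ → (ℕ → List ℕ)
  | 0, R, _, _ => R
  | f + 1, R, r, v =>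
    match (rowIns v (R r)).2 with
    | none => Function.update R r (rowIns v (R r)).1
    | some y => bumpRows f (Function.update R r (rowIns v (R r)).1) (r + 1) y

theorem bump_ofRows (f : ℕ) (ρ : ℕ → ℕ) (R : ℕ → List ℕ) (r v : ℕ) :
    bump f (ofRows ρ R) (r : ℤ) v = ofRows ρ (bumpRows f R r v) := by
  induction f generalizing R r v with
  | zero => rfl
  | succ f ih =>
    rcases rowIns_cases v (R r) with ⟨h1, h2⟩ | ⟨j, hj, h1, h2, h3⟩
    · have hne : ¬ ((Finset.Ico ((ofRows ρ R).rho r) ((ofRows ρ R).lam r)).filter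
          fun c => v < (ofRows ρ R).ent r c).Nonempty := by
        rintro ⟨c, hc⟩
        simp only [ofRows_rho_natCast, ofRows_lam_natCast, Finset.mem_filter, Finset.mem_Ico,
          ofRows_ent_natCast] at hc
        obtain ⟨⟨ha, hb⟩, hc⟩ := hc
        have hlt : c - ρ r < (R r).length := by omega
        rw [if_pos ha, List.getD_eq_getElem _ _ hlt] at hc
        exact absurd (h1 _ (List.getElem_mem hlt)) (by omega)
      rw [bump]
      simp only [dif_neg hne, bumpRows, h2]
      apply eq_ofRows
      · intro s hs
        have : s ≠ r := by omega
        simp [ofRows, this, hs.not_ge]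
      · intro s hs
        simp [ofRows, hs.not_ge]
      · intro s hs c
        have : s ≠ r := by omega
        simp [ofRows, this, hs.not_ge]
      · intro s
        by_cases hs : s = r
        · subst hs; simp; omega
        · simp [hs]
      · intro s; simp
      · intro s c
        by_cases hs : s = r
        · subst hs
          simp only [ofRows_lam_natCast, true_and, Function.update_self, ofRows_ent_natCast]
          by_cases hc : c = ρ s + (R s).length
          · simp [hc]
          · rw [if_neg hc]
            split_ifs with hc'
            · rcases lt_or_ge (c - ρ s) (R s).length with hl | hl
              · rw [List.getD_append _ _ _ _ hl]
              · rw [List.getD_eq_default _ _ hl, List.getD_eq_default]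
                simp; omega
            · rfl
        · simp [hs]
    · have hmem : ρ r + j ∈ (Finset.Ico ((ofRows ρ R).rho r) ((ofRows ρ R).lam r)).filter
          fun c => v < (ofRows ρ R).ent r c := by
        simp [hj, h1]
      have hmin : ∀ h, ((Finset.Ico ((ofRows ρ R).rho r) ((ofRows ρ R).lam r)).filter
          fun c => v < (ofRows ρ R).ent r c).min' h = ρ r + j := by
        intro h
        refine le_antisymm (Finset.min'_le _ _ hmem) (Finset.le_min' _ _ _ ?_)
        intro c hc
        simp only [ofRows_rho_natCast, ofRows_lam_natCast, Finset.mem_filter, Finset.mem_Ico,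
          ofRows_ent_natCast] at hc
        obtain ⟨⟨ha, hb⟩, hc⟩ := hc
        by_contra hlt
        have hlt' : c - ρ r < (R r).length := by omega
        rw [if_pos ha, List.getD_eq_getElem _ _ hlt'] at hc
        exact absurd (h2 (c - ρ r) (by omega)) (by omega)
      have hent : (ofRows ρ R).ent r (ρ r + j) = (R r)[j] := by simp [hj]
      rw [bump]
      simp only [hmin, bumpRows, h3, hent]
      rw [dif_pos ⟨_, hmem⟩, ← ih, Nat.cast_succ]
      congr 1
      apply eq_ofRows
      · intro s hs
        simp [ofRows, hs.not_ge]
      · intro s hs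
        simp [ofRows, hs.not_ge]
      · intro s hs c
        have : s ≠ r := by omega
        simp [ofRows, this, hs.not_ge]
      · intro s
        by_cases hs : s = r
        · subst hs; simp
        · simp [hs]
      · intro s; simp
      · intro s c
        by_cases hs : s = r
        · subst hs
          simp only [true_and, Function.update_self, ofRows_ent_natCast]
          by_cases hc : c = ρ s + j
          · simp [hc, hj]
          · rw [if_neg hc]
            split_ifs with hc'
            · rw [List.getD_eq_getElem?_getD, List.getD_eq_getElem?_getD, List.getElem?_set_ne]
              omega
            · rfl
        · simp [hs]

/-- The word bumped into row `r` when the first `b s` letters of every row `s` of `L` are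
inserted, in order, into the row below. -/
def feed (L : ℕ → List ℕ) (b : ℕ → ℕ) : ℕ → List ℕ
  | 0 => []
  | r + 1 => (L r).take (b r) ++ (wordIns (feed L b r) ((L r).drop (b r))).2

/-- The rows obtained from `L` by internally inserting the first `b s` letters of every
row `s`. -/
def insPass (L : ℕ → List ℕ) (b : ℕ → ℕ) (r : ℕ) : List ℕ :=
  (wordIns (feed L b r) ((L r).drop (b r))).1

/-- Bumping one more letter into row `s` of a cascade extends the incoming word of row `s`
by that letter. -/
theorem bumpRows_cascade (D X X' : ℕ → List ℕ) (I : ℕ → List ℕ)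
    (f : ℕ) : ∀ (R : ℕ → List ℕ) (s v : ℕ),
    (∀ t, s ≤ t → X (t + 1) = I t ++ (wordIns (X t) (D t)).2) →
    (∀ t, s ≤ t → X' (t + 1) = I t ++ (wordIns (X' t) (D t)).2) →
    X' s = X s ++ [v] →
    (∀ t, s ≤ t → R t = (wordIns (X t) (D t)).1) →
    (∀ t, s + f ≤ t + 1 → R t = []) → 0 < f →
    bumpRows f R s v = fun t => if t < s then R t else (wordIns (X' t) (D t)).1 := by
  induction f with
  | zero => intro R s v _ _ _ _ _ h; omega
  | succ f ih =>
    intro R s v hX hX' hs hR hE _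
    have hrow : wordIns (X' s) (D s) = ((rowIns v (R s)).1,
        (wordIns (X s) (D s)).2 ++ (rowIns v (R s)).2.toList) := by
      rw [hs, wordIns_concat, ← hR s le_rfl]
    rw [bumpRows]
    rcases hy : (rowIns v (R s)).2 with _ | y
    · have hXX : ∀ d, X' (s + 1 + d) = X (s + 1 + d) := by
        intro d
        induction d with
        | zero => rw [add_zero, hX' s le_rfl, hX s le_rfl, hrow, hy]; simp
        | succ d ihd => rw [← add_assoc, hX' _ (by omega), hX _ (by omega), ihd]
      funext t
      rcases lt_trichotomy t s with h | h | h
      · simp [h, h.ne]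
      · subst h; simp [hrow]
      · obtain ⟨d, rfl⟩ := Nat.exists_eq_add_of_le h
        simp only [Function.update_of_ne h.ne', if_neg h.not_gt]
        rw [hXX, hR _ h.le]
    · have hf : 0 < f := by
        rcases Nat.eq_zero_or_pos f with rfl | h
        · rw [hE s (by omega)] at hy
          simp [rowIns] at hy
        · exact h
      dsimp only
      rw [ih _ (s + 1) y (fun t ht => hX t (by omega)) (fun t ht => hX' t (by omega)) ?_ ?_ ?_ hf]
      · funext t
        rcases lt_trichotomy t s with h | h | h
        · simp [h, h.ne, Nat.lt_succ_of_lt h]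
        · subst h; simp [hrow]
        · have h1 : ¬ t < s + 1 := by omega
          simp [h1, h.not_gt]
      · rw [hX' s le_rfl, hX s le_rfl, hrow, hy]; simp
      · intro t ht
        rw [Function.update_of_ne (by omega)]
        exact hR t (by omega)
      · intro t ht
        rw [Function.update_of_ne (by omega)]
        exact hE t (by omega)

theorem length_wordIns_snd_le (xs l : List ℕ) : (wordIns xs l).2.length ≤ xs.length := by
  induction xs generalizing l with
  | nil => simp [wordIns]
  | cons x xs ih =>
    have h := ih (rowIns x l).1
    have h' : (rowIns x l).2.toList.length ≤ 1 := by cases (rowIns x l).2 <;> simp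
    simp only [wordIns, List.length_append, List.length_cons]
    omega

theorem length_wordIns_nil_snd_le (xs : List ℕ) : (wordIns xs []).2.length ≤ xs.length - 1 := by
  cases xs with
  | nil => simp [wordIns]
  | cons x xs => simpa [wordIns, rowIns] using length_wordIns_snd_le xs [x]

theorem pass_eventually_nil (L : ℕ → List ℕ) (b : ℕ → ℕ) (hL : ∃ N, ∀ t, N ≤ t → L t = []) :
    ∃ N, ∀ t, N ≤ t → insPass L b t = [] := by
  obtain ⟨N, hN⟩ := hL
  have h : ∀ d, (feed L b (N + d)).length ≤ (feed L b N).length - d := by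
    intro d
    induction d with
    | zero => simp
    | succ d ih =>
      have h := length_wordIns_nil_snd_le (feed L b (N + d))
      rw [← add_assoc, feed, hN _ (by omega)]
      simp only [List.take_nil, List.drop_nil, List.nil_append]
      omega
  refine ⟨N + (feed L b N).length, fun t ht => ?_⟩
  obtain ⟨d, rfl⟩ := Nat.exists_eq_add_of_le ht
  have h1 := h ((feed L b N).length + d)
  have h2 : feed L b (N + (feed L b N).length + d) = [] := by
    rw [← List.length_eq_zero_iff, add_assoc]; omega
  rw [insPass, h2, hN _ (by omega)]
  simp [wordIns]

theorem lam_eq_zero_of_rMax_le {T : Tab} (hb : ∃ N : ℤ, ∀ r, N ≤ r → T.lam r = 0)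
    (hne : ∃ r, T.lam r ≠ 0) {r : ℤ} (hr : rMax T ≤ r) : T.lam r = 0 := by
  obtain ⟨s, hs⟩ := hne
  refine Int.csInf_mem (s := {m : ℤ | ∀ r : ℤ, m ≤ r → T.lam r = 0}) hb ⟨s, fun m hm => ?_⟩ r hr
  by_contra h
  exact hs (hm s (by omega))

theorem lam_eq_zero_of_lt_rMin {T : Tab} (hb : ∃ N : ℤ, ∀ r, r < N → T.lam r = 0)
    (hne : ∃ r, T.lam r ≠ 0) {r : ℤ} (hr : r < rMin T) : T.lam r = 0 := by
  obtain ⟨s, hs⟩ := hne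
  refine Int.csSup_mem (s := {m : ℤ | ∀ r : ℤ, r < m → T.lam r = 0}) hb ⟨s, fun m hm => ?_⟩ r hr
  by_contra h
  exact hs (hm s (by omega))

theorem rMin_nonneg {T : Tab} (h : ∀ r < 0, T.lam r = 0) : 0 ≤ rMin T := by
  by_cases hb : BddAbove {m : ℤ | ∀ r : ℤ, r < m → T.lam r = 0}
  · exact le_csSup hb h
  · rw [rMin, Int.csSup_of_not_bddAbove hb]

theorem feed_eq_nil {L : ℕ → List ℕ} {b : ℕ → ℕ} {r : ℕ} (hb : ∀ t < r, b t = 0) :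
    ∀ t ≤ r, feed L b t = [] := by
  intro t
  induction t with
  | zero => intro _; rfl
  | succ t ih =>
    intro ht
    rw [feed, ih (by omega), hb t (by omega)]
    simp [wordIns]

theorem intIns_ofRows_pass {ρ : ℕ → ℕ} {L : ℕ → List ℕ} {b : ℕ → ℕ} {r : ℕ}
    (hL : ∃ N, ∀ t, N ≤ t → L t = []) (hρ : ∃ N, ∀ t, N ≤ t → ρ t = 0)
    (hb : ∀ t < r, b t = 0) (hr : b r < (L r).length) :
    intIns (ofRows ρ (insPass L b)) r =
      ofRows (Function.update ρ r (ρ r + 1)) (insPass L (Function.update b r (b r + 1))) := by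
  set b' := Function.update b r (b r + 1) with hb'
  have hb0 : ∀ t < r, b' t = 0 := fun t ht => by rw [hb', Function.update_of_ne ht.ne, hb t ht]
  have hbr : b' r = b r + 1 := by rw [hb', Function.update_self]
  have hrow : insPass L b r = (L r).drop (b r) := by
    rw [insPass, feed_eq_nil hb r le_rfl]; rfl
  have hrow' : insPass L b' r = (L r).drop (b r + 1) := by
    rw [insPass, feed_eq_nil hb0 r le_rfl, hbr]; rfl
  have hlen : 0 < (insPass L b r).length := by rw [hrow]; simp; omega
  have hlt : (ofRows ρ (insPass L b)).rho r < (ofRows ρ (insPass L b)).lam r := by simpa using hlen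
  have hbound : ∃ N : ℤ, ∀ t, N ≤ t → (ofRows ρ (insPass L b)).lam t = 0 := by
    obtain ⟨N₁, h₁⟩ := pass_eventually_nil L b hL
    obtain ⟨N₂, h₂⟩ := hρ
    refine ⟨(max N₁ N₂ : ℕ), fun t ht => ?_⟩
    lift t to ℕ using by omega
    simp [h₁ t (by omega), h₂ t (by omega)]
  have hmax : ∀ t : ℤ, rMax (ofRows ρ (insPass L b)) ≤ t → (ofRows ρ (insPass L b)).lam t = 0 :=
    fun t => lam_eq_zero_of_rMax_le hbound ⟨r, by omega⟩
  have hvac : Tab.mk (ofRows ρ (insPass L b)).lam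
      (fun r' => if r' = (r : ℤ) then (ofRows ρ (insPass L b)).rho r + 1
        else (ofRows ρ (insPass L b)).rho r')
      (fun r' c' => if r' = (r : ℤ) ∧ c' = (ofRows ρ (insPass L b)).rho r then 0
        else (ofRows ρ (insPass L b)).ent r' c') =
      ofRows (Function.update ρ r (ρ r + 1))
        (Function.update (insPass L b) r (insPass L b' r)) := by
    apply eq_ofRows
    · intro s hs
      simp [ofRows, hs.not_ge]
    · intro s hs
      have : s ≠ r := by omega
      simp [ofRows, hs.not_ge, this]
    · intro s hs c
      simp [ofRows, hs.not_ge]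
    · intro s
      by_cases hs : s = r
      · subst hs
        simp [hrow, hrow']
        omega
      · simp [hs]
    · intro s
      by_cases hs : s = r
      · subst hs; simp
      · simp [hs]
    · intro s c
      by_cases hs : s = r
      · subst hs
        simp only [true_and, Function.update_self, ofRows_ent_natCast, ofRows_rho_natCast, hrow,
          hrow']
        rcases lt_trichotomy c (ρ s) with h | h | h
        · rw [if_neg h.ne, if_neg (by omega), if_neg (by omega)]
        · simp [h]
        · rw [if_neg h.ne', if_pos h.le, if_pos (by omega)]
          simp only [List.getD_eq_getElem?_getD, List.getElem?_drop]
          congr 2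
          omega
      · simp [hs]
  have hent : (ofRows ρ (insPass L b)).ent r ((ofRows ρ (insPass L b)).rho r) = (L r)[b r] := by
    simp [hrow, hr]
  rw [intIns, if_pos hlt, hvac, hent, ← Nat.cast_succ, bump_ofRows]
  congr 1
  have hne : ∀ t, r < t → b' t = b t := fun t ht => by rw [hb', Function.update_of_ne ht.ne']
  rw [bumpRows_cascade (fun t => (L t).drop (b' t)) (feed L b) (feed L b')
    (fun t => (L t).take (b' t))]
  · funext t
    rcases lt_trichotomy t r with h | h | h
    · simp only [Function.update_of_ne h.ne, if_pos (Nat.lt_succ_of_lt h), insPass]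
      rw [feed_eq_nil hb t h.le, feed_eq_nil hb0 t h.le, hb t h, hb0 t h]
    · subst h; simp
    · rw [if_neg (by omega)]; rfl
  · intro t ht
    simp only [feed, hne t ht]
  · intro t ht
    simp only [feed]
  · simp only [feed, feed_eq_nil hb r le_rfl, feed_eq_nil hb0 r le_rfl, wordIns, hbr]
    simp
  · intro t ht
    simp only [hne t ht, Function.update_of_ne (show t ≠ r by omega), insPass]
  · intro t ht
    have h := hmax t (by omega)
    rw [Function.update_of_ne (show t ≠ r by omega)]
    simp only [ofRows_lam_natCast] at h
    rw [← List.length_eq_zero_iff]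
    omega
  · omega

theorem iterate_intIns_ofRows_insPass {ρ : ℕ → ℕ} {L : ℕ → List ℕ} {b : ℕ → ℕ} {r : ℕ}
    (hL : ∃ N, ∀ t, N ≤ t → L t = []) (hρ : ∃ N, ∀ t, N ≤ t → ρ t + b t = 0)
    (hb : ∀ t ≤ r, b t = 0) (m : ℕ) (hm : m ≤ (L r).length) :
    (fun S => intIns S r)^[m] (ofRows (fun t => ρ t + b t) (insPass L b)) =
      ofRows (fun t => ρ t + Function.update b r m t) (insPass L (Function.update b r m)) := by
  induction m with
  | zero =>
    have : Function.update b r 0 = b := by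
      rw [← hb r le_rfl, Function.update_eq_self]
    simp [this]
  | succ m ih =>
    rw [Function.iterate_succ_apply', ih (by omega), intIns_ofRows_pass hL]
    · congr 1
      · funext t
        by_cases h : t = r
        · subst h; simp [add_assoc]
        · simp [h]
      · simp
    · obtain ⟨N, hN⟩ := hρ
      refine ⟨max N (r + 1), fun t ht => ?_⟩
      rw [Function.update_of_ne (by omega)]
      exact hN t (by omega)
    · intro t ht
      rw [Function.update_of_ne ht.ne, hb t ht.le]
    · simpa using hm

theorem ones_eq_zero {Q : Tab} {r : ℤ} (h : Q.lam r = 0) : ones Q r = 0 := by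
  simp [ones, h]

theorem foldl_intIns_ofRows {ρ : ℕ → ℕ} {L : ℕ → List ℕ} {Q : Tab}
    (hL : ∃ N, ∀ t, N ≤ t → L t = []) (hρ : ∃ N, ∀ t, N ≤ t → ρ t = 0)
    (hneg : ∀ r < 0, Q.lam r = 0) (hfin : ∃ N : ℤ, ∀ r, N ≤ r → Q.lam r = 0)
    (hones : ∀ r : ℕ, ones Q r ≤ (L r).length) :
    ((List.range (rMax Q - rMin Q).toNat).map fun t : ℕ => rMax Q - 1 - (t : ℤ)).foldl
        (fun S r => (fun S' => intIns S' r)^[ones Q r] S) (ofRows ρ L) =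
      ofRows (fun r => ρ r + ones Q r) (insPass L fun r => ones Q r) := by
  have hmax : ∀ r, rMax Q ≤ r → ones Q r = 0 := by
    intro r hr
    by_contra h
    exact h (ones_eq_zero (lam_eq_zero_of_rMax_le hfin ⟨r, fun h' => h (ones_eq_zero h')⟩ hr))
  have hmin : ∀ r, r < rMin Q → ones Q r = 0 := by
    intro r hr
    by_contra h
    exact h (ones_eq_zero (lam_eq_zero_of_lt_rMin ⟨0, hneg⟩ ⟨r, fun h' => h (ones_eq_zero h')⟩ hr))
  have hnonneg := rMin_nonneg hneg
  have key : ∀ d ≤ (rMax Q - rMin Q).toNat,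
      ((List.range d).map fun t : ℕ => rMax Q - 1 - (t : ℤ)).foldl
        (fun S r => (fun S' => intIns S' r)^[ones Q r] S) (ofRows ρ L) =
      ofRows (fun r => ρ r + if rMax Q - d ≤ r then ones Q r else 0)
        (insPass L fun r => if rMax Q - d ≤ r then ones Q r else 0) := by
    intro d
    induction d with
    | zero =>
      intro _
      have h0 : ∀ r : ℕ, (if rMax Q - (0 : ℕ) ≤ r then ones Q r else 0) = 0 := by
        intro r
        split_ifs with h
        · exact hmax r (by simpa using h)
        · rfl
      have hp : insPass L (fun _ => 0) = L := by
        funext t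
        rw [insPass, feed_eq_nil (r := t) (fun _ _ => rfl) t le_rfl]
        rfl
      simp only [h0, hp]
      simp
    | succ d ih =>
      intro hd
      rw [List.range_succ, List.map_append, List.foldl_append, ih (by omega)]
      simp only [List.map_cons, List.map_nil, List.foldl_cons, List.foldl_nil]
      obtain ⟨r, hr⟩ : ∃ r : ℕ, rMax Q - 1 - (d : ℤ) = r :=
        ⟨(rMax Q - 1 - (d : ℤ)).toNat, by omega⟩
      have hupd : Function.update (fun t : ℕ => if rMax Q - d ≤ t then ones Q t else 0) r
          (ones Q r) = fun t : ℕ => if rMax Q - (d + 1 : ℕ) ≤ t then ones Q t else 0 := by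
        funext t
        by_cases h : t = r
        · subst h
          rw [Function.update_self, if_pos (by omega)]
        · rw [Function.update_of_ne h]
          have : rMax Q - d ≤ t ↔ rMax Q - (d + 1 : ℕ) ≤ t := by omega
          simp only [this]
      have hit := iterate_intIns_ofRows_insPass (ρ := ρ)
        (b := fun t : ℕ => if rMax Q - d ≤ t then ones Q t else 0) hL ?_ ?_ _ (hones r)
      · rw [hupd] at hit
        rw [hr]
        exact hit
      · obtain ⟨N, hN⟩ := hρ
        refine ⟨max N (rMax Q).toNat, fun t ht => ?_⟩
        rw [hN t (by omega), hmax t (by omega)]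
        simp
      · intro t ht
        exact if_neg (by omega)
  have h0 : ∀ r : ℕ, (if rMax Q - (rMax Q - rMin Q).toNat ≤ r then ones Q r else 0)
      = ones Q r := by
    intro r
    split_ifs with h
    · rfl
    · exact (hmin r (by omega)).symm
  rw [key _ le_rfl]
  simp only [h0]

theorem ones_ofRows {ρ : ℕ → ℕ} {M : ℕ → List ℕ} {r b : ℕ} {l : List ℕ}
    (hM : M r = List.replicate b 1 ++ l) (hl : 1 ∉ l) : ones (ofRows ρ M) r = b := by
  have h : ((Finset.Ico (ρ r) (ρ r + (M r).length)).filter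
      fun c => (ofRows ρ M).ent r c = 1) = Finset.Ico (ρ r) (ρ r + b) := by
    ext c
    simp only [Finset.mem_filter, Finset.mem_Ico, ofRows_ent_natCast, hM, List.length_append,
      List.length_replicate]
    constructor
    · rintro ⟨⟨h1, h2⟩, h3⟩
      refine ⟨h1, ?_⟩
      by_contra h4
      have hlt : c - ρ r - b < l.length := by omega
      rw [if_pos h1, List.getD_append_right _ _ _ _ (by simp; omega), List.length_replicate,
        List.getD_eq_getElem _ _ hlt] at h3
      exact hl (h3 ▸ List.getElem_mem hlt)
    · rintro ⟨h1, h2⟩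
      refine ⟨⟨h1, by omega⟩, ?_⟩
      rw [if_pos h1, List.getD_append _ _ _ _ (by simp; omega),
        List.getD_eq_getElem _ _ (by simp; omega)]
      simp
  rw [ones, ofRows_rho_natCast, ofRows_lam_natCast, h]
  simp

theorem map_natCast_bind (l : List ℕ) (f : ℤ → ℤ) :
    (List.map f do let a ← l; pure (a : ℤ)) = l.map fun t : ℕ => f t := by
  induction l with
  | nil => rfl
  | cons a l ih => simpa using ih

theorem iota2_ofRows (n : ℕ) {ρ a b : ℕ → ℕ} {L M M' : ℕ → List ℕ}
    (hL : ∃ N, ∀ t, N ≤ t → L t = []) (hM : ∃ N, ∀ t, N ≤ t → M t = [])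
    (hρ : ∃ N, ∀ t, N ≤ t → ρ t = 0)
    (hMM : ∀ r, M r = List.replicate (b r) 1 ++ M' r) (hM' : ∀ r, 1 ∉ M' r)
    (hb : ∀ r, b r ≤ (L r).length) (ha : ∀ r, (insPass L b r).length = (M' r).length + a r) :
    iota2 n (ofRows ρ L, ofRows ρ M) =
      (ofRows (fun r => ρ r + b r) (insPass L b),
        ofRows (fun r => ρ r + b r) fun r => (M' r).map (· - 1) ++ List.replicate (a r) n) := by
  have hones : ∀ r : ℕ, ones (ofRows ρ M) r = b r := fun r => ones_ofRows (hMM r) (hM' r)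
  have hfin : ∃ N : ℤ, ∀ r, N ≤ r → (ofRows ρ M).lam r = 0 := by
    obtain ⟨N₁, h₁⟩ := hM
    obtain ⟨N₂, h₂⟩ := hρ
    refine ⟨(max N₁ N₂ : ℕ), fun t ht => ?_⟩
    lift t to ℕ using by omega
    simp [h₁ t (by omega), h₂ t (by omega)]
  have hneg : ∀ r < 0, (ofRows ρ M).lam r = 0 := fun r hr => by simp [ofRows, hr.not_ge]
  have hfold := foldl_intIns_ofRows hL hρ hneg hfin (fun r => by rw [hones]; exact hb r)
  simp only [hones] at hfold
  simp only [iota2, map_natCast_bind, hfold]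
  congr 1
  apply eq_ofRows
  · intro r hr; simp [ofRows, hr.not_ge]
  · intro r hr; simp [ofRows, hr.not_ge]
  · intro r hr c; simp [ofRows, hr.not_ge]
  · intro r
    simp [ha]
  · intro r; simp
  · intro r c
    simp only [ofRows_rho_natCast, ofRows_lam_natCast, ofRows_ent_natCast, hones, ha, hMM,
      List.length_append, List.length_replicate]
    by_cases h1 : ρ r + b r ≤ c
    · by_cases h2 : c - (ρ r + b r) < (M' r).length
      · rw [if_pos (by omega), if_pos (by omega), if_pos (by omega), if_pos h1,
          List.getD_append_right _ _ _ _ (by simp; omega),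
          List.getD_append _ _ _ _ (by simpa using h2), List.getD_eq_getElem _ _ (by simp; omega),
          List.getD_eq_getElem _ _ (by simpa using h2)]
        simp [Nat.sub_sub]
      · by_cases h3 : c - (ρ r + b r) < (M' r).length + a r
        · rw [if_pos (by omega), if_neg (by omega), if_pos h1,
            List.getD_append_right _ _ _ _ (by simp; omega),
            List.getD_eq_getElem _ _ (by simp; omega)]
          simp
        · rw [if_neg (by omega), if_pos h1, List.getD_eq_default _ _ (by simp; omega)]
    · rw [if_neg (by omega), if_neg h1]

theorem wordIns_cons_of_le {a : ℕ} {xs : List ℕ} (l : List ℕ) (h : ∀ x ∈ xs, a ≤ x) :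
    wordIns xs (a :: l) = (a :: (wordIns xs l).1, (wordIns xs l).2) := by
  induction xs generalizing l with
  | nil => rfl
  | cons x xs ih =>
    have hx : ¬ x < a := (h x (by simp)).not_gt
    simp [wordIns, rowIns, hx, ih _ fun y hy => h y (by simp [hy])]

theorem wordIns_replicate_append_of_le {a : ℕ} {xs : List ℕ} (m : ℕ) (l : List ℕ)
    (h : ∀ x ∈ xs, a ≤ x) :
    wordIns xs (List.replicate m a ++ l) =
      (List.replicate m a ++ (wordIns xs l).1, (wordIns xs l).2) := by
  induction m with
  | zero => simp
  | succ m ih => simp [List.replicate_succ, wordIns_cons_of_le _ h, ih]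

theorem wordIns_cons_cons_of_lt {a x : ℕ} {xs : List ℕ} (l : List ℕ) (hx : x < a)
    (h : ∀ y ∈ xs, x ≤ y) :
    wordIns (x :: xs) (a :: l) = (x :: (wordIns xs l).1, a :: (wordIns xs l).2) := by
  simp [wordIns, rowIns, hx, wordIns_cons_of_le _ h]

theorem wordIns_replicate_append_replicate {a x : ℕ} {xs : List ℕ} (m : ℕ) (l : List ℕ)
    (hx : x < a) (h : ∀ y ∈ xs, x ≤ y) :
    wordIns (List.replicate m x ++ xs) (List.replicate m a ++ l) =
      (List.replicate m x ++ (wordIns xs l).1, List.replicate m a ++ (wordIns xs l).2) := by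
  induction m with
  | zero => simp
  | succ m ih =>
    have h' : ∀ y ∈ List.replicate m x ++ xs, x ≤ y := by
      intro y hy
      rcases List.mem_append.mp hy with hy | hy
      · exact (List.eq_of_mem_replicate hy).ge
      · exact h y hy
    simp only [List.replicate_succ, List.cons_append, wordIns_cons_cons_of_lt _ hx h', ih]

theorem wordIns_nil {xs : List ℕ} (h : xs.Pairwise (· ≤ ·)) : wordIns xs [] = (xs, []) := by
  induction xs with
  | nil => rfl
  | cons x xs ih =>
    rw [List.pairwise_cons] at h
    simp [wordIns, rowIns, wordIns_cons_of_le _ h.1, ih h.2]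

/-- Every entry of the second word exceeds the entry of the first word in its position. -/
def Exceeds : List ℕ → List ℕ → Prop
  | _, [] => True
  | [], _ :: _ => False
  | x :: xs, y :: ys => x < y ∧ Exceeds xs ys

theorem wordIns_of_exceeds {xs ys : List ℕ} (h : xs.Pairwise (· ≤ ·)) (hd : Exceeds xs ys) :
    wordIns xs ys = (xs, ys) := by
  induction xs generalizing ys with
  | nil =>
    cases ys with
    | nil => rfl
    | cons y ys => exact hd.elim
  | cons x xs ih =>
    cases ys with
    | nil => exact wordIns_nil h
    | cons y ys =>
      rw [List.pairwise_cons] at h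
      rw [wordIns_cons_cons_of_lt _ hd.1 h.1, ih h.2 hd.2]

theorem Exceeds.cons_left {i : ℕ} {xs ys : List ℕ} (h : (i :: xs).Pairwise (· ≤ ·))
    (hd : Exceeds xs ys) : Exceeds (i :: xs) ys := by
  induction xs generalizing i ys with
  | nil =>
    cases ys with
    | nil => trivial
    | cons y ys => exact hd.elim
  | cons x xs ih =>
    cases ys with
    | nil => trivial
    | cons y ys =>
      rw [List.pairwise_cons] at h
      exact ⟨(h.1 x (by simp)).trans_lt hd.1, ih h.2 hd.2⟩

theorem pairwise_replicate_append {i : ℕ} {xs : List ℕ} (m : ℕ) (h : xs.Pairwise (· ≤ ·))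
    (hi : ∀ x ∈ xs, i ≤ x) : (List.replicate m i ++ xs).Pairwise (· ≤ ·) := by
  refine List.pairwise_append.mpr ⟨List.pairwise_replicate.mpr (Or.inr le_rfl), h, ?_⟩
  intro a ha b hb
  rw [List.eq_of_mem_replicate ha]
  exact hi b hb

theorem Exceeds.replicate_append {i j a b : ℕ} {xs ys : List ℕ} (h : xs.Pairwise (· ≤ ·))
    (hi : ∀ x ∈ xs, i ≤ x) (hij : i < j) (hab : b ≤ a) (hd : Exceeds xs ys) :
    Exceeds (List.replicate a i ++ xs) (List.replicate b j ++ ys) := by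
  induction a generalizing b with
  | zero =>
    obtain rfl : b = 0 := by omega
    simpa using hd
  | succ a ih =>
    cases b with
    | zero =>
      refine Exceeds.cons_left (pairwise_replicate_append (a + 1) h hi) ?_
      exact ih (Nat.zero_le a)
    | succ b => exact ⟨hij, ih (by omega)⟩

/-- The weakly increasing word with `f j` letters `j + 1` for `i ≤ j < i + l`. -/
def letters (f : ℕ → ℕ) : ℕ → ℕ → List ℕ
  | _, 0 => []
  | i, l + 1 => List.replicate (f i) (i + 1) ++ letters f (i + 1) l

theorem letters_succ (f : ℕ → ℕ) (i l : ℕ) :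
    letters f i (l + 1) = List.replicate (f i) (i + 1) ++ letters f (i + 1) l := rfl

theorem lt_of_mem_letters {f : ℕ → ℕ} {i l x : ℕ} (h : x ∈ letters f i l) : i < x := by
  induction l generalizing i with
  | zero => simp [letters] at h
  | succ l ih =>
    rcases List.mem_append.mp h with h | h
    · rw [List.eq_of_mem_replicate h]; exact Nat.lt_succ_self i
    · have := ih h; omega

theorem pairwise_letters (f : ℕ → ℕ) (i l : ℕ) : (letters f i l).Pairwise (· ≤ ·) := by
  induction l generalizing i with
  | zero => exact List.Pairwise.nil
  | succ l ih => exact pairwise_replicate_append _ (ih _) fun x hx => (lt_of_mem_letters hx).le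

theorem letters_congr_of_lt {f g : ℕ → ℕ} {i : ℕ} (l : ℕ)
    (h : ∀ j, j < i + l → f j = g j) : letters f i l = letters g i l := by
  induction l generalizing i with
  | zero => rfl
  | succ l ih =>
    rw [letters_succ, letters_succ, h i (by omega), ih fun j hj => h j (by omega)]

theorem letters_congr {f g : ℕ → ℕ} {i : ℕ} (l : ℕ) (h : ∀ j, i ≤ j → f j = g j) :
    letters f i l = letters g i l := by
  induction l generalizing i with
  | zero => rfl
  | succ l ih => rw [letters, letters, h i le_rfl, ih fun j hj => h j (by omega)]

theorem exceeds_letters {x s : ℕ → ℕ} (h : ∀ j, s (j + 1) ≤ x j) (i l : ℕ) :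
    Exceeds (letters x i (l + 1)) (letters s (i + 1) l) := by
  induction l generalizing i with
  | zero => cases letters x i 1 <;> trivial
  | succ l ih =>
    exact Exceeds.replicate_append (pairwise_letters _ _ _) (fun y hy => (lt_of_mem_letters hy).le)
      (Nat.lt_succ_self _) (h i) (ih (i + 1))

theorem wordIns_letters {u s x : ℕ → ℕ} {k : ℕ} (h : ∀ j, s (j + 1) ≤ x j)
    (hk : ∀ j < k, x j = s (j + 1)) (hu : ∀ j, k ≤ j → u j = 0) (i l : ℕ) :
    wordIns (letters x i (l + 1))
        (List.replicate (u i) (i + 1) ++ letters (fun j => u j + s j) (i + 1) l) =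
      (letters (fun j => u j + x j) i (l + 1), letters s (i + 1) l) := by
  induction l generalizing i with
  | zero =>
    rw [show letters (fun j => u j + s j) (i + 1) 0 = [] from rfl,
      wordIns_replicate_append_of_le _ _ fun y hy => Nat.succ_le_of_lt (lt_of_mem_letters hy),
      wordIns_nil (pairwise_letters _ _ _)]
    simp [letters]
  | succ l ih =>
    rcases le_or_gt k i with hi | hi
    · have hus : letters (fun j => u j + s j) (i + 1) (l + 1) = letters s (i + 1) (l + 1) :=
        letters_congr _ fun j hj => by simp [hu j (by omega)]
      have hux : letters (fun j => u j + x j) i (l + 2) = letters x i (l + 2) :=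
        letters_congr _ fun j hj => by simp [hu j (by omega)]
      rw [hus, hux, hu i hi, List.replicate_zero, List.nil_append,
        wordIns_of_exceeds (pairwise_letters _ _ _) (exceeds_letters h i (l + 1))]
    · rw [wordIns_replicate_append_of_le _ _ fun y hy => Nat.succ_le_of_lt (lt_of_mem_letters hy),
        letters_succ x, letters_succ (fun j => u j + s j), letters_succ (fun j => u j + x j),
        letters_succ s, hk i hi, add_comm (u (i + 1)), List.replicate_add, List.append_assoc,
        wordIns_replicate_append_replicate _ _ (Nat.lt_succ_self _)
          fun y hy => (lt_of_mem_letters hy).le, ih]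
      simp only [List.replicate_add, List.append_assoc]

theorem letters_succ_last (f : ℕ → ℕ) (i l : ℕ) :
    letters f i (l + 1) = letters f i l ++ List.replicate (f (i + l)) (i + l + 1) := by
  induction l generalizing i with
  | zero => simp [letters]
  | succ l ih =>
    rw [letters_succ, ih (i + 1), letters_succ f i l, List.append_assoc]
    congr 3 <;> ring_nf

theorem map_pred_letters (f : ℕ → ℕ) (i l : ℕ) :
    (letters f (i + 1) l).map (· - 1) = letters (fun j => f (j + 1)) i l := by
  induction l generalizing i with
  | zero => rfl
  | succ l ih =>
    rw [letters_succ, letters_succ, List.map_append, ih]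
    simp

theorem length_letters (f : ℕ → ℕ) (l : ℕ) :
    (letters f 0 l).length = ∑ j ∈ Finset.range l, f j := by
  induction l with
  | zero => rfl
  | succ l ih => rw [letters_succ_last, Finset.sum_range_succ, List.length_append, ih]; simp

theorem letters_eq_nil {f : ℕ → ℕ} (h : ∀ j, f j = 0) (l : ℕ) : letters f 0 l = [] := by
  rw [← List.length_eq_zero_iff, length_letters]
  simp [h]

theorem getD_letters (f : ℕ → ℕ) (l o : ℕ) (ho : o < ∑ j ∈ Finset.range l, f j) :
    (letters f 0 l).getD o 0 = 1 + sInf {i : ℕ | o < ∑ j ∈ Finset.range (i + 1), f j} := by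
  induction l with
  | zero => simp at ho
  | succ l ih =>
    rw [letters_succ_last]
    rcases lt_or_ge o (∑ j ∈ Finset.range l, f j) with h | h
    · rw [List.getD_append _ _ _ _ (by rwa [length_letters]), ih h]
    · have hinf : sInf {i : ℕ | o < ∑ j ∈ Finset.range (i + 1), f j} = l := by
        refine le_antisymm (Nat.sInf_le ho) (le_csInf ⟨l, ho⟩ fun i hi => ?_)
        by_contra hil
        have hsub : ∑ j ∈ Finset.range (i + 1), f j ≤ ∑ j ∈ Finset.range l, f j :=
          Finset.sum_le_sum_of_subset (Finset.range_subset_range.mpr (by omega))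
        exact absurd (hi.trans_le hsub) h.not_gt
      rw [Finset.sum_range_succ] at ho
      rw [hinf, List.getD_append_right _ _ _ _ (by rwa [length_letters]), length_letters,
        List.getD_eq_getElem _ _ (by simp; omega)]
      simp [add_comm]

theorem aMat_eq_zero_of_lt (μ κ : ℕ → ℕ) {i r : ℕ} (h : r < i) : aMat μ κ i r = 0 := by
  rw [aMat, Finset.card_eq_zero, Finset.filter_eq_empty_iff]
  intro c _
  omega

theorem aMat_eq_zero_of_le {μ : ℕ → ℕ} {n : ℕ} (hn : ∀ c, conj μ c ≤ n) (κ : ℕ → ℕ) {i : ℕ}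
    (h : n ≤ i) (r : ℕ) : aMat μ κ i r = 0 := by
  rw [aMat, Finset.card_eq_zero, Finset.filter_eq_empty_iff]
  intro c _
  have := hn c
  omega

theorem exists_aMat_eq_zero (μ κ : ℕ → ℕ) : ∃ N, ∀ r, N ≤ r → ∀ i, aMat μ κ i r = 0 := by
  refine ⟨∑ c ∈ Finset.range (μ 0), (κ c + conj μ c), fun r hr i => ?_⟩
  rw [aMat, Finset.card_eq_zero, Finset.filter_eq_empty_iff]
  intro c hc
  have := Finset.single_le_sum (f := fun c => κ c + conj μ c) (fun _ _ => Nat.zero_le _) hc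
  omega

theorem exists_rhoLd_eq_zero (μ κ : ℕ → ℕ) {ν : ℕ → ℕ}
    (hν : (∀ i j : ℕ, i ≤ j → ν j ≤ ν i) ∧ ∃ N, ν N = 0) :
    ∃ N, ∀ r, N ≤ r → rhoLd μ κ ν r = 0 := by
  obtain ⟨hν, M, hM⟩ := hν
  refine ⟨max M (∑ c ∈ Finset.range (μ 0), κ c), fun r hr => ?_⟩
  have h1 := hν M r (by omega)
  rw [rhoLd, Nat.add_eq_zero_iff, Finset.card_eq_zero, Finset.filter_eq_empty_iff]
  refine ⟨fun c hc => ?_, by omega⟩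
  have := Finset.single_le_sum (f := κ) (fun _ _ => Nat.zero_le _) hc
  omega

theorem sum_aMat {μ : ℕ → ℕ} {n : ℕ} (hn : ∀ c, conj μ c ≤ n) (κ : ℕ → ℕ) (r : ℕ) :
    ∑ i ∈ Finset.range n, aMat μ κ i r =
      ((Finset.range (μ 0)).filter fun c => κ c ≤ r ∧ r < κ c + conj μ c).card := by
  simp only [aMat, Finset.card_filter]
  rw [Finset.sum_comm]
  refine Finset.sum_congr rfl fun c _ => ?_
  have := hn c
  split_ifs with h
  · rw [Finset.sum_eq_single (r - κ c)]
    · rw [if_pos (by omega)]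
    · intro i _ hi
      rw [if_neg (by omega)]
    · intro hi
      rw [Finset.mem_range] at hi
      omega
  · refine Finset.sum_eq_zero fun i _ => if_neg ?_
    omega

theorem thetaRow_eq {μ : ℕ → ℕ} {n : ℕ} (hn : ∀ c, conj μ c ≤ n) (κ : ℕ → ℕ) (r : ℕ) :
    thetaRow μ κ r = ∑ i ∈ Finset.range n, aMat μ κ i r := by
  rw [thetaRow, ← Finset.eventually_constant_sum (fun i hi => aMat_eq_zero_of_lt μ κ hi)
    (le_max_left (r + 1) n)]
  exact Finset.eventually_constant_sum (fun i hi => aMat_eq_zero_of_le hn κ hi r) (le_max_right _ _)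

theorem leadingTab_eq_ofRows {μ : ℕ → ℕ} {n : ℕ} (hn : ∀ c, conj μ c ≤ n) (κ ν : ℕ → ℕ) :
    leadingTab μ κ ν =
      ofRows (rhoLd μ κ ν) fun r => letters (fun i => aMat μ κ i r) 0 n := by
  apply eq_ofRows
  · intro r hr; simp [leadingTab, hr.not_ge]
  · intro r hr; simp [leadingTab, hr.not_ge]
  · intro r hr c; simp [leadingTab, hr.not_ge]
  · intro r
    simp [leadingTab, length_letters, thetaRow_eq hn]
  · intro r; simp [leadingTab]
  · intro r c
    simp only [leadingTab, Int.natCast_nonneg, Int.toNat_natCast, true_and, thetaRow_eq hn]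
    by_cases h1 : rhoLd μ κ ν r ≤ c
    · by_cases h2 : c - rhoLd μ κ ν r < ∑ i ∈ Finset.range n, aMat μ κ i r
      · rw [if_pos (by omega), if_pos h1, getD_letters _ _ _ h2, entLd]
      · rw [if_neg (by omega), if_pos h1, List.getD_eq_default]
        rw [length_letters]; omega
    · rw [if_neg (by omega), if_neg h1]

/-- The number of columns of length more than `k` whose letter `i + 1` lies in row `r + 1`. -/
noncomputable def longMat (μ κ : ℕ → ℕ) (k i r : ℕ) : ℕ :=
  ((Finset.range (μ 0)).filter fun c => k < conj μ c ∧ i < conj μ c ∧ r = κ c + i).card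

/-- The number of columns of length at most `k` whose letter `i + 1` lies in row `r + 1`. -/
noncomputable def shortMat (μ κ : ℕ → ℕ) (k i r : ℕ) : ℕ :=
  ((Finset.range (μ 0)).filter fun c => conj μ c ≤ k ∧ i < conj μ c ∧ r = κ c + i).card

/-- The number of columns of length more than `k` whose letter `i + 1` lies in row `r`. -/
noncomputable def longMatPrev (μ κ : ℕ → ℕ) (k i r : ℕ) : ℕ :=
  ((Finset.range (μ 0)).filter fun c => k < conj μ c ∧ i < conj μ c ∧ r = κ c + i + 1).card

/-- The starting rows of the columns after `k` steps: each column moves down by one row per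
step until it has moved by its length. -/
noncomputable def shift (μ κ : ℕ → ℕ) (k c : ℕ) : ℕ := κ c + min k (conj μ c)

theorem aMat_eq_short_add_long (μ κ : ℕ → ℕ) (k i r : ℕ) :
    aMat μ κ i r = shortMat μ κ k i r + longMat μ κ k i r := by
  simp only [aMat, shortMat, longMat, Finset.card_filter, ← Finset.sum_add_distrib]
  refine Finset.sum_congr rfl fun c _ => ?_
  split_ifs <;> omega

theorem aMat_shift_succ (μ κ : ℕ → ℕ) (k i r : ℕ) :
    aMat μ (shift μ κ (k + 1)) i r =
      shortMat μ (shift μ κ k) k i r + longMatPrev μ (shift μ κ k) k i r := by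
  simp only [aMat, shortMat, longMatPrev, Finset.card_filter, ← Finset.sum_add_distrib]
  refine Finset.sum_congr rfl fun c _ => ?_
  have h₁ : shift μ κ k c = κ c + min k (conj μ c) := rfl
  have h₂ : shift μ κ (k + 1) c = κ c + min (k + 1) (conj μ c) := rfl
  split_ifs <;> omega

theorem longMatPrev_succ (μ κ : ℕ → ℕ) (k i r : ℕ) :
    longMatPrev μ κ k i (r + 1) = longMat μ κ k i r := by
  simp only [longMatPrev, longMat, Nat.add_right_cancel_iff]

theorem longMat_succ_le (μ κ : ℕ → ℕ) (k i r : ℕ) :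
    longMat μ κ k (i + 1) r ≤ longMatPrev μ κ k i r := by
  refine Finset.card_le_card (Finset.monotone_filter_right _ ?_)
  intro c _ h
  omega

theorem longMatPrev_eq {k i : ℕ} (h : i < k) (μ κ : ℕ → ℕ) (r : ℕ) :
    longMatPrev μ κ k i r = longMat μ κ k (i + 1) r := by
  unfold longMatPrev longMat
  congr 1
  refine Finset.filter_congr fun c _ => ?_
  omega

theorem shortMat_eq_zero {k i : ℕ} (h : k ≤ i) (μ κ : ℕ → ℕ) (r : ℕ) :
    shortMat μ κ k i r = 0 := by
  rw [shortMat, Finset.card_eq_zero, Finset.filter_eq_empty_iff]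
  intro c _
  omega

theorem letters_aMat_eq (μ κ : ℕ → ℕ) (k n r : ℕ) :
    letters (fun i => aMat μ κ i r) 0 (n + 1) = List.replicate (longMat μ κ k 0 r) 1 ++
      (List.replicate (shortMat μ κ k 0 r) 1 ++
        letters (fun i => shortMat μ κ k i r + longMat μ κ k i r) 1 n) := by
  rw [letters_succ, aMat_eq_short_add_long μ κ k, add_comm (shortMat _ _ _ _ _),
    List.replicate_add, List.append_assoc]
  simp only [zero_add, aMat_eq_short_add_long μ κ k]

theorem wordIns_longMatPrev (μ κ : ℕ → ℕ) (k n r : ℕ) :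
    wordIns (letters (fun i => longMatPrev μ κ k i r) 0 (n + 1))
      ((letters (fun i => aMat μ κ i r) 0 (n + 1)).drop (longMat μ κ k 0 r)) =
    (letters (fun i => shortMat μ κ k i r + longMatPrev μ κ k i r) 0 (n + 1),
      letters (fun i => longMat μ κ k i r) 1 n) := by
  rw [letters_aMat_eq μ κ k, List.drop_left' (by simp)]
  exact wordIns_letters (fun j => longMat_succ_le μ κ k j r) (fun j hj => longMatPrev_eq hj μ κ r)
    (fun j hj => shortMat_eq_zero hj μ κ r) 0 n

theorem feed_letters_aMat (μ κ : ℕ → ℕ) (k n r : ℕ) :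
    feed (fun r => letters (fun i => aMat μ κ i r) 0 (n + 1)) (longMat μ κ k 0) r =
      letters (fun i => longMatPrev μ κ k i r) 0 (n + 1) := by
  induction r with
  | zero =>
    refine (letters_eq_nil (fun i => ?_) _).symm
    rw [longMatPrev, Finset.card_eq_zero, Finset.filter_eq_empty_iff]
    intro c _
    omega
  | succ r ih =>
    rw [feed, ih, wordIns_longMatPrev, letters_aMat_eq μ κ k, List.take_left' (by simp)]
    simp only [longMatPrev_succ]
    rfl

theorem insPass_letters_aMat (μ κ : ℕ → ℕ) (k n : ℕ) :
    insPass (fun r => letters (fun i => aMat μ (shift μ κ k) i r) 0 (n + 1))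
        (longMat μ (shift μ κ k) k 0) =
      fun r => letters (fun i => aMat μ (shift μ κ (k + 1)) i r) 0 (n + 1) := by
  funext r
  rw [insPass, feed_letters_aMat, wordIns_longMatPrev]
  simp only [aMat_shift_succ]

theorem rhoLd_shift_succ (μ κ ν : ℕ → ℕ) (k r : ℕ) :
    rhoLd μ (shift μ κ (k + 1)) ν r =
      rhoLd μ (shift μ κ k) ν r + longMat μ (shift μ κ k) k 0 r := by
  rw [rhoLd, rhoLd, add_right_comm]
  congr 1
  simp only [longMat, Finset.card_filter, ← Finset.sum_add_distrib]
  refine Finset.sum_congr rfl fun c _ => ?_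
  have h₁ : shift μ κ k c = κ c + min k (conj μ c) := rfl
  have h₂ : shift μ κ (k + 1) c = κ c + min (k + 1) (conj μ c) := rfl
  split_ifs <;> omega

/-- Multiplicities of the letters of the recording tableau in row `r + 1`: the original letters
`i + 1 ≤ n`, followed by the letters added in the successive steps, numbered from `n + 1`. -/
noncomputable def recMat (μ κ : ℕ → ℕ) (n r i : ℕ) : ℕ :=
  if i < n then aMat μ κ i r else aMat μ (fun c => κ c + conj μ c) (i - n) r

theorem longMat_shift_zero {k n : ℕ} (hk : k < n) (μ κ : ℕ → ℕ) (r : ℕ) :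
    longMat μ (shift μ κ k) k 0 r = recMat μ κ n r k := by
  rw [recMat, if_pos hk, longMat, aMat]
  congr 1
  refine Finset.filter_congr fun c _ => ?_
  rw [shift]
  omega

theorem sum_recMat {μ : ℕ → ℕ} {n : ℕ} (hn : ∀ c, conj μ c ≤ n) (κ : ℕ → ℕ) (r : ℕ) {k : ℕ}
    (hk : k ≤ n) : ∑ t ∈ Finset.range n, recMat μ κ n r (k + t) =
      ∑ i ∈ Finset.range n, aMat μ (shift μ κ k) i r := by
  induction k with
  | zero =>
    have hs : shift μ κ 0 = κ := by funext c; simp [shift]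
    refine Finset.sum_congr rfl fun i hi => ?_
    simp [recMat, Finset.mem_range.mp hi, hs]
  | succ k ih =>
    have h1 := Finset.sum_range_succ (fun t => recMat μ κ n r (k + t)) n
    have h2 := Finset.sum_range_succ' (fun t => recMat μ κ n r (k + t)) n
    have h3 : ∑ t ∈ Finset.range n, recMat μ κ n r (k + (t + 1)) =
        ∑ t ∈ Finset.range n, recMat μ κ n r (k + 1 + t) :=
      Finset.sum_congr rfl fun t _ => by rw [add_assoc, add_comm 1 t]
    have h4 : ∑ i ∈ Finset.range n, aMat μ (shift μ κ (k + 1)) i r + recMat μ κ n r k =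
        ∑ i ∈ Finset.range n, aMat μ (shift μ κ k) i r + recMat μ κ n r (k + n) := by
      rw [sum_aMat hn, sum_aMat hn, recMat, recMat, if_pos (by omega), if_neg (by omega)]
      simp only [aMat, Finset.card_filter, ← Finset.sum_add_distrib]
      refine Finset.sum_congr rfl fun c _ => ?_
      have h₁ : shift μ κ k c = κ c + min k (conj μ c) := rfl
      have h₂ : shift μ κ (k + 1) c = κ c + min (k + 1) (conj μ c) := rfl
      split_ifs <;> omega
    have h5 := ih (by omega)
    simp only [add_zero] at h2
    omega

theorem exists_recMat_eq_zero (μ κ : ℕ → ℕ) (n : ℕ) :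
    ∃ N, ∀ r, N ≤ r → ∀ i, recMat μ κ n r i = 0 := by
  obtain ⟨N₁, h₁⟩ := exists_aMat_eq_zero μ κ
  obtain ⟨N₂, h₂⟩ := exists_aMat_eq_zero μ fun c => κ c + conj μ c
  refine ⟨max N₁ N₂, fun r hr i => ?_⟩
  rw [recMat, h₁ r (by omega), h₂ r (by omega), ite_self]

theorem iota2_step {μ : ℕ → ℕ} {n : ℕ} (hn : ∀ c, conj μ c ≤ n) (κ : ℕ → ℕ) {ν : ℕ → ℕ}
    (hν : (∀ i j : ℕ, i ≤ j → ν j ≤ ν i) ∧ ∃ N, ν N = 0) {k : ℕ} (hk : k < n) :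
    iota2 n
        (ofRows (rhoLd μ (shift μ κ k) ν)
          (fun r => letters (fun i => aMat μ (shift μ κ k) i r) 0 n),
        ofRows (rhoLd μ (shift μ κ k) ν) fun r => letters (fun i => recMat μ κ n r (k + i)) 0 n) =
      (ofRows (rhoLd μ (shift μ κ (k + 1)) ν)
          (fun r => letters (fun i => aMat μ (shift μ κ (k + 1)) i r) 0 n),
        ofRows (rhoLd μ (shift μ κ (k + 1)) ν)
          fun r => letters (fun i => recMat μ κ n r (k + 1 + i)) 0 n) := by
  obtain ⟨p, rfl⟩ : ∃ p, n = p + 1 := ⟨n - 1, by omega⟩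
  rw [iota2_ofRows (p + 1) (a := fun r => recMat μ κ (p + 1) r (k + (p + 1)))
    (b := longMat μ (shift μ κ k) k 0)
    (M' := fun r => letters (fun i => recMat μ κ (p + 1) r (k + i)) 1 p)]
  · have hρ : (fun r => rhoLd μ (shift μ κ k) ν r + longMat μ (shift μ κ k) k 0 r) =
        rhoLd μ (shift μ κ (k + 1)) ν := funext fun r => (rhoLd_shift_succ μ κ ν k r).symm
    rw [hρ, insPass_letters_aMat]
    congr 2
    funext r
    rw [map_pred_letters, letters_succ_last]
    congr 1
    · exact letters_congr _ fun j _ => by rw [add_assoc, add_comm 1 j]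
    · congr 2
      · ring
      · ring
  · obtain ⟨N, hN⟩ := exists_aMat_eq_zero μ (shift μ κ k)
    exact ⟨N, fun r hr => letters_eq_nil (hN r hr) _⟩
  · obtain ⟨N, hN⟩ := exists_recMat_eq_zero μ κ (p + 1)
    exact ⟨N, fun r hr => letters_eq_nil (fun i => hN r hr _) _⟩
  · exact exists_rhoLd_eq_zero μ _ hν
  · intro r
    rw [letters_succ, longMat_shift_zero hk]
    rfl
  · intro r h
    exact absurd (lt_of_mem_letters h) (lt_irrefl 1)
  · intro r
    rw [letters_aMat_eq μ _ k]
    simp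
  · intro r
    have h1 := sum_recMat hn κ r (k := k + 1) hk
    rw [insPass_letters_aMat, length_letters, ← h1, ← length_letters, letters_succ_last,
      List.length_append, List.length_replicate]
    have h2 : letters (fun i => recMat μ κ (p + 1) r (k + 1 + i)) 0 p =
        (letters (fun i => recMat μ κ (p + 1) r (k + i)) 1 p).map (· - 1) := by
      rw [map_pred_letters]
      exact letters_congr _ fun j _ => by rw [add_assoc, add_comm 1 j]
    rw [h2, List.length_map]
    congr 2
    ring

theorem conj_le {f : ℕ → ℕ} (hf : ∀ i j : ℕ, i ≤ j → f j ≤ f i) {n : ℕ} (hn : f n = 0) (c : ℕ) :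
    conj f c ≤ n := by
  have hsub : {r : ℕ | c + 1 ≤ f r} ⊆ (Finset.range n : Set ℕ) := by
    intro r hr
    simp only [Finset.coe_range, Set.mem_Iio]
    by_contra h
    have h1 := hf n r (by omega)
    have h2 : c + 1 ≤ f r := hr
    omega
  have := Set.ncard_le_ncard hsub (Finset.finite_toSet _)
  rwa [Set.ncard_coe_finset, Finset.card_range] at this

/-- The skew RSK map acts on leading tableaux by the linear shift `κ ↦ κ + μ'`:
if `T = T(μ,κ;ν)` then `RSK(T,T) = (T',T')` with `T' = T(μ, κ + μ'; ν)` (again a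
leading tableau). -/
theorem skewRSK_on_leading_tableaux (n : ℕ) (μ : {f : ℕ → ℕ //
      (∀ i j : ℕ, i ≤ j → f j ≤ f i) ∧ ∃ N, f N = 0})
    (κ ν : ℕ → ℕ)
    (hκ0 : ∀ c, μ.val 0 ≤ c → κ c = 0)
    (hκK : ∀ c, c + 1 < μ.val 0 → conj μ.val c = conj μ.val (c + 1) → κ (c + 1) ≤ κ c)
    (hν : (∀ i j : ℕ, i ≤ j → ν j ≤ ν i) ∧ ∃ N, ν N = 0)
    (hn : μ.val n = 0) :
    skewRSKt n (leadingTab μ.val κ ν, leadingTab μ.val κ ν)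
      = (leadingTab μ.val (fun c => κ c + conj μ.val c) ν,
         leadingTab μ.val (fun c => κ c + conj μ.val c) ν) := by
  have hc : ∀ c, conj μ.val c ≤ n := conj_le μ.2.1 hn
  have key : ∀ k ≤ n, (iota2 n)^[k] (leadingTab μ.val κ ν, leadingTab μ.val κ ν) =
      (ofRows (rhoLd μ.val (shift μ.val κ k) ν)
          (fun r => letters (fun i => aMat μ.val (shift μ.val κ k) i r) 0 n),
        ofRows (rhoLd μ.val (shift μ.val κ k) ν)
          fun r => letters (fun i => recMat μ.val κ n r (k + i)) 0 n) := by
    intro k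
    induction k with
    | zero =>
      intro _
      have hs : shift μ.val κ 0 = κ := by funext c; simp [shift]
      have hl : ∀ r, letters (fun i => recMat μ.val κ n r (0 + i)) 0 n =
          letters (fun i => aMat μ.val κ i r) 0 n := by
        intro r
        refine letters_congr_of_lt _ fun j hj => ?_
        rw [zero_add] at hj
        rw [zero_add, recMat, if_pos hj]
      simp only [Function.iterate_zero, id_eq, leadingTab_eq_ofRows hc, hs, hl]
    | succ k ih =>
      intro hk
      rw [Function.iterate_succ_apply', ih (by omega), iota2_step hc κ hν hk]
  have hs : shift μ.val κ n = fun c => κ c + conj μ.val c := by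
    funext c
    rw [shift, min_eq_right (hc c)]
  have hl : ∀ r, letters (fun i => recMat μ.val κ n r (n + i)) 0 n =
      letters (fun i => aMat μ.val (fun c => κ c + conj μ.val c) i r) 0 n := by
    intro r
    refine letters_congr _ fun j _ => ?_
    rw [recMat, if_neg (by omega), Nat.add_sub_cancel_left]
  rw [skewRSKt, key n le_rfl]
  simp only [hs, hl, leadingTab_eq_ofRows hc]
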